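/- Let G = ⊕_{n≥0} G_n be a positively graded Noetherian ring with (G_0, 𝔫) local, G = G_0[G_1], and G_0/𝔫 infinite, let L be a finitely generated graded G-module, and let d ≥ 2 be an integer with dim_G L ≤ d. Assume dim_{G_0}(L_n) < dim_G(L) for every n ≥ 0. Then for a general element f ∈ G_1 (i.e., for all f in a suitable nonempty Zariski-open set of choices modulo 𝔫G_1) one has dim_G(L/fL) ≤ d−1 and j_d(G, L) = j_{d−1}(G, L/fL). -/

import Mathlib

open Filter

noncomputable section

/-- The length of a module, as the height of `⊤` in the submodule lattice. -/
def mLength (R M : Type*) [CommRing R] [AddCommGroup M] [Module R M] : ℕ∞ :=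
  Order.height (⊤ : Submodule R M)

/-- The Krull dimension of a module, via the annihilator. -/
def mDim (R M : Type*) [CommRing R] [AddCommGroup M] [Module R M] : WithBot ℕ∞ :=
  ringKrullDim (R ⧸ Module.annihilator R M)

/-- `H⁰_I(N)`: elements killed by a power of `I` (0-th local cohomology). -/
def H0 {R : Type*} [CommRing R] (I : Ideal R) (N : Type*) [AddCommGroup N] [Module R N] :
    Submodule R N :=
  ⨆ n : ℕ, Submodule.torsionBySet R N ((I ^ n : Ideal R) : Set R)

/-- The irrelevant ideal `G₊` of a positively graded ring: the ideal generated by the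
homogeneous elements of positive degree. -/
def gPlus {R G : Type*} [CommRing R] [CommRing G] [Algebra R G]
    (𝒜 : ℕ → Submodule R G) : Ideal G :=
  Ideal.span {x : G | ∃ n : ℕ, 0 < n ∧ x ∈ 𝒜 n}

/-- `f` is `G₊`-filter regular for a `G`-module `L`: `f ∉ P` for every associated prime
`P` of `L` with `G₊ ⊄ P`. -/
def FilterRegular {R G : Type*} [CommRing R] [CommRing G] [Algebra R G]
    (𝒜 : ℕ → Submodule R G) (f : G) (L : Type*) [AddCommGroup L] [Module G L] : Prop :=
  ∀ P ∈ associatedPrimes G L, ¬ gPlus 𝒜 ≤ P → f ∉ P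

/-- The `j`-multiplicity `j_d(G, L)` of a graded module `L` with components `comp` over a
graded ring `G` with `𝔫G = nG`: the limit of `(d−1)!/n^(d−1) · length_{G₀} Wₙ`, where
`W = H⁰_{𝔫G}(L)` and `Wₙ` is its `n`-th graded component. -/
def jMultGr (R : Type*) {G : Type*} [CommRing R] [CommRing G] [Algebra R G] (nG : Ideal G)
    (L : Type*) [AddCommGroup L] [Module R L] [Module G L] [IsScalarTower R G L]
    (comp : ℕ → Submodule R L) (d : ℕ) : ℝ :=
  limUnder atTop fun n : ℕ =>
    ((d - 1).factorial : ℝ) / (n : ℝ) ^ (d - 1) *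
      ((mLength R (Submodule.restrictScalars R (H0 nG L) ⊓ comp n : Submodule R L)).toNat : ℝ)


/-- "For a general element `f ∈ G₁`" (i.e., for all `f` in a suitable nonempty Zariski-open
set of choices modulo `𝔫G₁`): for every finite family generating `G₁` over `G₀ = R`, there
is a polynomial with nonzero image over the residue field such that `P f` holds for every
coefficient combination `f` avoiding its zero locus. -/
def GeneralDeg1 {R G : Type*} [CommRing R] [IsLocalRing R] [CommRing G] [Algebra R G]
    (𝒜 : ℕ → Submodule R G) (P : G → Prop) : Prop :=
  ∀ (m : ℕ) (x : Fin m → G), (∀ l, x l ∈ 𝒜 1) →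
    Submodule.span R (Set.range x) = 𝒜 1 →
    ∃ F : MvPolynomial (Fin m) R,
      MvPolynomial.map (Ideal.Quotient.mk (IsLocalRing.maximalIdeal R)) F ≠ 0 ∧
      ∀ c : Fin m → R,
        MvPolynomial.eval (fun l => Ideal.Quotient.mk (IsLocalRing.maximalIdeal R) (c l))
          (MvPolynomial.map (Ideal.Quotient.mk (IsLocalRing.maximalIdeal R)) F) ≠ 0 →
        P (∑ l, c l • x l)

section Avoidance

/-- A linear form over the residue field detecting that a combination lies outside a
submodule which misses one of the generators. -/
theorem exists_mvPolynomial_notMem {R M : Type*} [CommRing R] [IsLocalRing R]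
    [AddCommGroup M] [Module R M] {m : ℕ} (x : Fin m → M) (p : Submodule R M)
    (hp : ¬ Submodule.span R (Set.range x) ≤ p) :
    ∃ F : MvPolynomial (Fin m) R,
      MvPolynomial.map (Ideal.Quotient.mk (IsLocalRing.maximalIdeal R)) F ≠ 0 ∧
      ∀ c : Fin m → R,
        MvPolynomial.eval (fun l => Ideal.Quotient.mk (IsLocalRing.maximalIdeal R) (c l))
          (MvPolynomial.map (Ideal.Quotient.mk (IsLocalRing.maximalIdeal R)) F) ≠ 0 →
        ∑ l, c l • x l ∉ p := by
  set V : Submodule R (Fin m → R) := p.comap (Fintype.linearCombination R x) with hV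
  have hVtop : V ≠ ⊤ := by
    intro h
    apply hp
    rw [Submodule.span_le]
    rintro _ ⟨l, rfl⟩
    have : (Pi.single l (1 : R) : Fin m → R) ∈ V := h ▸ Submodule.mem_top
    simpa [hV, Submodule.mem_comap] using this
  obtain ⟨U, hU, hVU⟩ := (eq_top_or_exists_le_coatom V).resolve_left hVtop
  have hsimple : IsSimpleModule R ((Fin m → R) ⧸ U) := isSimpleModule_iff_isCoatom.mpr hU
  obtain ⟨I, hI, ⟨e⟩⟩ := isSimpleModule_iff_quot_maximal.mp hsimple
  obtain rfl : I = IsLocalRing.maximalIdeal R := IsLocalRing.eq_maximalIdeal hI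
  set φ : (Fin m → R) →ₗ[R] R ⧸ IsLocalRing.maximalIdeal R := e.toLinearMap ∘ₗ U.mkQ with hφ
  have hker : ∀ c, c ∈ V → φ c = 0 := by
    intro c hc
    have : U.mkQ c = 0 := by simpa using hVU hc
    simp [hφ, this]
  have hφsum : ∀ c : Fin m → R, φ c = ∑ l,
      φ (Pi.single l 1) * Ideal.Quotient.mk (IsLocalRing.maximalIdeal R) (c l) := by
    intro c
    conv_lhs => rw [pi_eq_sum_univ' c]
    rw [map_sum]
    refine Finset.sum_congr rfl fun l _ => ?_
    rw [map_smul, mul_comm, Algebra.smul_def]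
    congr 2
  choose a ha using fun l => Ideal.Quotient.mk_surjective (φ (Pi.single l 1))
  have heval : ∀ t : Fin m → R ⧸ IsLocalRing.maximalIdeal R,
      MvPolynomial.eval t (MvPolynomial.map (Ideal.Quotient.mk (IsLocalRing.maximalIdeal R))
        (∑ l, MvPolynomial.C (a l) * MvPolynomial.X l)) = ∑ l, φ (Pi.single l 1) * t l := by
    intro t
    simp [ha]
  refine ⟨∑ l, MvPolynomial.C (a l) * MvPolynomial.X l, ?_, ?_⟩
  · intro h0
    obtain ⟨y, hy⟩ := e.surjective 1
    obtain ⟨c, rfl⟩ := U.mkQ_surjective y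
    have h1 : φ c = 1 := hy
    rw [hφsum, ← heval, h0, map_zero] at h1
    exact zero_ne_one h1
  · intro c hc hmem
    rw [heval, ← hφsum] at hc
    exact hc (hker c (by simpa [hV, Fintype.linearCombination_apply] using hmem))

/-- Prime avoidance by a general linear combination of generators. -/
theorem exists_mvPolynomial_forall_notMem {R M : Type*} [CommRing R] [IsLocalRing R]
    [AddCommGroup M] [Module R M] {m : ℕ} (x : Fin m → M) {S : Set (Submodule R M)}
    (hS : S.Finite) (hp : ∀ p ∈ S, ¬ Submodule.span R (Set.range x) ≤ p) :
    ∃ F : MvPolynomial (Fin m) R,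
      MvPolynomial.map (Ideal.Quotient.mk (IsLocalRing.maximalIdeal R)) F ≠ 0 ∧
      ∀ c : Fin m → R,
        MvPolynomial.eval (fun l => Ideal.Quotient.mk (IsLocalRing.maximalIdeal R) (c l))
          (MvPolynomial.map (Ideal.Quotient.mk (IsLocalRing.maximalIdeal R)) F) ≠ 0 →
        ∀ p ∈ S, ∑ l, c l • x l ∉ p := by
  induction S, hS using Set.Finite.induction_on with
  | empty => exact ⟨1, by simp, by simp⟩
  | @insert p T _ _ ih =>
    obtain ⟨F, hF, hF'⟩ := ih fun q hq => hp q (Set.mem_insert_of_mem _ hq)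
    obtain ⟨H, hH, hH'⟩ := exists_mvPolynomial_notMem x p (hp p (Set.mem_insert _ _))
    refine ⟨F * H, by rw [map_mul]; exact mul_ne_zero hF hH, fun c hc => ?_⟩
    rw [map_mul, map_mul] at hc
    rintro q (rfl | hq)
    · exact hH' c (right_ne_zero_of_mul hc)
    · exact hF' c (left_ne_zero_of_mul hc) q hq

/-- Over an infinite residue field some combination of generators avoids finitely many
submodules, none of which contains all the generators. -/
theorem exists_mem_forall_notMem {R M : Type*} [CommRing R] [IsLocalRing R]
    [Infinite (IsLocalRing.ResidueField R)]
    [AddCommGroup M] [Module R M] {N : Submodule R M} (hN : N.FG) {S : Set (Submodule R M)}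
    (hS : S.Finite) (hp : ∀ p ∈ S, ¬ N ≤ p) :
    ∃ f ∈ N, ∀ p ∈ S, f ∉ p := by
  obtain ⟨m, x, rfl⟩ := Submodule.fg_iff_exists_fin_generating_family.mp hN
  obtain ⟨F, hF, hF'⟩ := exists_mvPolynomial_forall_notMem x hS hp
  have : Infinite (R ⧸ IsLocalRing.maximalIdeal R) :=
    ‹Infinite (IsLocalRing.ResidueField R)›
  have hex : ∃ t : Fin m → R ⧸ IsLocalRing.maximalIdeal R, MvPolynomial.eval t
      (MvPolynomial.map (Ideal.Quotient.mk (IsLocalRing.maximalIdeal R)) F) ≠ 0 := by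
    by_contra! h
    exact hF (MvPolynomial.funext fun t => by rw [h t, map_zero])
  obtain ⟨t, ht⟩ := hex
  choose c hc using fun l => Ideal.Quotient.mk_surjective (t l)
  refine ⟨∑ l, c l • x l, Submodule.sum_mem _ fun l _ => Submodule.smul_mem _ _
    (Submodule.subset_span ⟨l, rfl⟩), hF' c ?_⟩
  simpa [hc] using ht

end Avoidance

section Dimension

/-- If no minimal prime of `I` of large dimension contains `J ≥ I`, the dimension drops. -/
theorem ringKrullDim_quotient_le_of_minimalPrimes {A : Type*} [CommRing A] {I J : Ideal A}
    (hIJ : I ≤ J) {e : ℕ} (hI : ringKrullDim (A ⧸ I) ≤ ((e + 1 : ℕ) : WithBot ℕ∞))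
    (h : ∀ P ∈ I.minimalPrimes, J ≤ P → ringKrullDim (A ⧸ P) ≤ (e : WithBot ℕ∞)) :
    ringKrullDim (A ⧸ J) ≤ (e : WithBot ℕ∞) := by
  rw [ringKrullDim_quotient]
  refine iSup_le fun l => ?_
  have hJl : J ≤ l.head.1.asIdeal := l.head.2
  obtain ⟨P, hP, hPl⟩ := Ideal.exists_minimalPrimes_le (hIJ.trans hJl)
  have hmem : ∀ q : PrimeSpectrum.zeroLocus (R := A) J, l.head ≤ q → P ≤ q.1.asIdeal :=
    fun q hq => hPl.trans hq
  by_cases hJP : J ≤ P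
  · refine le_trans ?_ (h P hP hJP)
    rw [ringKrullDim_quotient]
    let l' : LTSeries (PrimeSpectrum.zeroLocus (R := A) P) :=
      { length := l.length
        toFun := fun i => ⟨(l i).1, hmem _ (LTSeries.head_le l i)⟩
        step := fun i => l.step i }
    exact Order.LTSeries.length_le_krullDim l'
  · rw [ringKrullDim_quotient] at hI
    let l' : LTSeries (PrimeSpectrum.zeroLocus (R := A) I) :=
      l.map (fun q => ⟨q.1, hIJ.trans q.2⟩) (fun _ _ hab => hab)
    let P' : PrimeSpectrum.zeroLocus (R := A) I := ⟨⟨P, hP.1.1⟩, hP.1.2⟩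
    have hlt : P' < l'.head := by
      refine lt_of_le_of_ne hPl fun heq => hJP ?_
      have : P = l.head.1.asIdeal := congrArg (fun q => q.1.asIdeal) heq
      rw [this]; exact hJl
    have := (Order.LTSeries.length_le_krullDim (l'.cons P' hlt)).trans hI
    have h2 : l.length + 1 ≤ e + 1 := by
      have h3 : (l'.cons P' hlt).length = l.length + 1 := by simp [l', LTSeries.map]
      rw [h3] at this
      exact_mod_cast this
    have h4 : l.length ≤ e := by omega
    exact_mod_cast h4

theorem ringKrullDim_quotient_le_of_forall_isPrime {A : Type*} [CommRing A] {I J : Ideal A}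
    (h : ∀ P : Ideal A, P.IsPrime → J ≤ P → I ≤ P) :
    ringKrullDim (A ⧸ J) ≤ ringKrullDim (A ⧸ I) := by
  rw [ringKrullDim_quotient, ringKrullDim_quotient]
  exact Order.krullDim_le_of_strictMono
    (fun q : PrimeSpectrum.zeroLocus (R := A) J =>
      (⟨q.1, h _ q.1.2 q.2⟩ : PrimeSpectrum.zeroLocus (R := A) I)) fun _ _ hab => hab

end Dimension

/-- A grading on a `G`-module `N`, recorded through its components and projections. -/
structure ModuleGrading {R G : Type*} [CommRing R] [CommRing G] [Algebra R G]
    (𝒜 : ℕ → Submodule R G) (N : Type*) [AddCommGroup N] [Module R N] [Module G N] where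
  comp : ℕ → Submodule R N
  proj : ℕ → N →+ N
  proj_mem : ∀ n x, proj n x ∈ comp n
  proj_of_mem : ∀ n x, x ∈ comp n → proj n x = x
  proj_of_mem_ne : ∀ n m x, x ∈ comp n → n ≠ m → proj m x = 0
  sum_proj : ∀ x, ∃ s : Finset ℕ, ∑ i ∈ s, proj i x = x
  smul_mem : ∀ i j g x, g ∈ 𝒜 i → x ∈ comp j → g • x ∈ comp (i + j)

namespace ModuleGrading

section Basic

variable {R G : Type*} [CommRing R] [CommRing G] [Algebra R G]
    {𝒜 : ℕ → Submodule R G} {N : Type*} [AddCommGroup N] [Module R N] [Module G N]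

/-- A submodule is homogeneous when it is stable under the projections. -/
def IsHomog (𝒢 : ModuleGrading 𝒜 N) (K : Submodule G N) : Prop :=
  ∀ x ∈ K, ∀ n, 𝒢.proj n x ∈ K

/-- The grading given by a decomposition. -/
def ofDecomposition (ℳ : ℕ → Submodule R N) [DirectSum.Decomposition ℳ]
    [SetLike.GradedSMul 𝒜 ℳ] : ModuleGrading 𝒜 N where
  comp := ℳ
  proj n :=
    { toFun := fun x => (DirectSum.decompose ℳ x n : N)
      map_zero' := by simp
      map_add' := fun x y => by simp }
  proj_mem n x := (DirectSum.decompose ℳ x n).2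
  proj_of_mem n x hx := DirectSum.decompose_of_mem_same ℳ hx
  proj_of_mem_ne n m x hx h := DirectSum.decompose_of_mem_ne ℳ hx h
  sum_proj x := by
    classical
    exact ⟨_, DirectSum.sum_support_decompose ℳ x⟩
  smul_mem i j g x hg hx := SetLike.GradedSMul.smul_mem hg hx

/-- The induced grading on the quotient by a homogeneous submodule. -/
def quotient [IsScalarTower R G N] (𝒢 : ModuleGrading 𝒜 N) (K : Submodule G N)
    (hK : 𝒢.IsHomog K) : ModuleGrading 𝒜 (N ⧸ K) where
  comp n := Submodule.map (K.mkQ.restrictScalars R) (𝒢.comp n)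
  proj n := QuotientAddGroup.map K.toAddSubgroup K.toAddSubgroup (𝒢.proj n)
    (fun x hx => hK x hx n)
  proj_mem n x := by
    obtain ⟨x, rfl⟩ := K.mkQ_surjective x
    exact ⟨𝒢.proj n x, 𝒢.proj_mem n x, rfl⟩
  proj_of_mem n x hx := by
    obtain ⟨x, hx, rfl⟩ := hx
    exact congrArg K.mkQ (𝒢.proj_of_mem n x hx)
  proj_of_mem_ne n m x hx h := by
    obtain ⟨x, hx, rfl⟩ := hx
    exact (congrArg K.mkQ (𝒢.proj_of_mem_ne n m x hx h)).trans (map_zero _)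
  sum_proj x := by
    obtain ⟨x, rfl⟩ := K.mkQ_surjective x
    obtain ⟨s, hs⟩ := 𝒢.sum_proj x
    exact ⟨s, (map_sum K.mkQ _ s).symm.trans (congrArg K.mkQ hs)⟩
  smul_mem i j g x hg hx := by
    obtain ⟨x, hx, rfl⟩ := hx
    exact ⟨g • x, 𝒢.smul_mem i j g x hg hx, map_smul K.mkQ g x⟩

/-- The induced grading on a homogeneous submodule. -/
def sub [IsScalarTower R G N] (𝒢 : ModuleGrading 𝒜 N) (K : Submodule G N)
    (hK : 𝒢.IsHomog K) : ModuleGrading 𝒜 K where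
  comp n := (𝒢.comp n).comap (K.subtype.restrictScalars R)
  proj n := ((𝒢.proj n).comp K.subtype.toAddMonoidHom).codRestrict K (fun x => hK x x.2 n)
  proj_mem n x := 𝒢.proj_mem n x
  proj_of_mem n x hx := Subtype.ext (𝒢.proj_of_mem n x hx)
  proj_of_mem_ne n m x hx h := Subtype.ext (𝒢.proj_of_mem_ne n m x hx h)
  sum_proj x := by
    obtain ⟨s, hs⟩ := 𝒢.sum_proj x
    refine ⟨s, Subtype.ext ?_⟩
    rw [AddSubmonoidClass.coe_finsetSum]
    exact hs
  smul_mem i j g x hg hx := 𝒢.smul_mem i j g x hg hx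

theorem induction_on (𝒢 : ModuleGrading 𝒜 N) {p : N → Prop} (h0 : p 0)
    (hadd : ∀ x y, p x → p y → p (x + y)) (hcomp : ∀ n x, x ∈ 𝒢.comp n → p x) (x : N) : p x := by
  obtain ⟨s, hs⟩ := 𝒢.sum_proj x
  rw [← hs]
  exact Finset.sum_induction _ p hadd h0 fun i _ => hcomp i _ (𝒢.proj_mem i x)

theorem proj_smul_add [GradedAlgebra 𝒜] (𝒢 : ModuleGrading 𝒜 N) {i n : ℕ} {x : N}
    (hx : x ∈ 𝒢.comp i) (g : G) :
    𝒢.proj (n + i) (g • x) = (DirectSum.decompose 𝒜 g n : G) • x := by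
  induction g using DirectSum.Decomposition.inductionOn 𝒜 with
  | zero => simp
  | @homogeneous j g =>
    by_cases h : j = n
    · subst h
      rw [DirectSum.decompose_coe, DirectSum.of_eq_same]
      exact 𝒢.proj_of_mem _ _ (𝒢.smul_mem _ _ _ _ g.2 hx)
    · rw [DirectSum.decompose_coe, DirectSum.of_eq_of_ne _ _ _ (Ne.symm h),
        𝒢.proj_of_mem_ne _ _ _ (𝒢.smul_mem _ _ _ _ g.2 hx) (by omega)]
      simp
  | add a b ha hb => rw [add_smul, map_add, ha, hb, DirectSum.decompose_add]; simp [add_smul]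

theorem proj_smul_mem (𝒢 : ModuleGrading 𝒜 N) {f : G} {i : ℕ} (hf : f ∈ 𝒜 i) (x : N) (n : ℕ) :
    ∃ y, 𝒢.proj n (f • x) = f • y := by
  induction x using 𝒢.induction_on with
  | h0 => exact ⟨0, by simp⟩
  | hadd x y hx hy =>
    obtain ⟨a, ha⟩ := hx
    obtain ⟨b, hb⟩ := hy
    exact ⟨a + b, by rw [smul_add, map_add, ha, hb, smul_add]⟩
  | hcomp m x hx =>
    by_cases h : i + m = n
    · exact ⟨x, 𝒢.proj_of_mem _ _ (h ▸ 𝒢.smul_mem _ _ _ _ hf hx)⟩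
    · exact ⟨0, by rw [𝒢.proj_of_mem_ne _ _ _ (𝒢.smul_mem _ _ _ _ hf hx) h, smul_zero]⟩

theorem mem_span_smul_top {f : G} {z : N} :
    z ∈ (Ideal.span {f} • ⊤ : Submodule G N) ↔ ∃ y, z = f • y := by
  rw [Submodule.ideal_span_singleton_smul, Submodule.mem_smul_pointwise_iff_exists]
  exact ⟨fun ⟨y, _, h⟩ => ⟨y, h.symm⟩, fun ⟨y, h⟩ => ⟨y, trivial, h.symm⟩⟩

theorem isHomog_span_smul_top (𝒢 : ModuleGrading 𝒜 N) {f : G} {i : ℕ} (hf : f ∈ 𝒜 i) :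
    𝒢.IsHomog (Ideal.span {f} • ⊤ : Submodule G N) := by
  intro z hz n
  obtain ⟨y, rfl⟩ := mem_span_smul_top.mp hz
  exact mem_span_smul_top.mpr (𝒢.proj_smul_mem hf y n)

theorem isHomog_map_mkQ [IsScalarTower R G N] (𝒢 : ModuleGrading 𝒜 N) {K W : Submodule G N}
    (hK : 𝒢.IsHomog K) (hW : 𝒢.IsHomog W) :
    (𝒢.quotient K hK).IsHomog (W.map K.mkQ) := by
  rintro _ ⟨x, hx, rfl⟩ n
  exact ⟨𝒢.proj n x, hW x hx n, rfl⟩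

/-- The projections are linear over the degree zero ring. -/
theorem proj_smul [GradedAlgebra 𝒜] [IsScalarTower R G N] (𝒢 : ModuleGrading 𝒜 N) (r : R) (x : N)
    (n : ℕ) : 𝒢.proj n (r • x) = r • 𝒢.proj n x := by
  induction x using 𝒢.induction_on with
  | h0 => simp
  | hadd x y hx hy => rw [smul_add, map_add, hx, hy, map_add, smul_add]
  | hcomp m x hx =>
    by_cases h : m = n
    · subst h
      rw [𝒢.proj_of_mem _ _ hx, 𝒢.proj_of_mem _ _ (Submodule.smul_mem _ r hx)]
    · rw [𝒢.proj_of_mem_ne _ _ _ hx h,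
        𝒢.proj_of_mem_ne _ _ _ (Submodule.smul_mem _ r hx) h, smul_zero]

theorem proj_smul_of_lt (𝒢 : ModuleGrading 𝒜 N) [GradedAlgebra 𝒜] {i n : ℕ} {x : N}
    (hx : x ∈ 𝒢.comp i) (hn : n < i) (g : G) : 𝒢.proj n (g • x) = 0 := by
  induction g using DirectSum.Decomposition.inductionOn 𝒜 with
  | zero => simp
  | @homogeneous j g =>
    exact 𝒢.proj_of_mem_ne _ _ _ (𝒢.smul_mem _ _ _ _ g.2 hx) (by omega)
  | add a b ha hb => rw [add_smul, map_add, ha, hb, add_zero]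

/-- Homogeneous elements killed by all large degree elements of the ring live in bounded
degrees. -/
theorem exists_forall_ge_eq_zero [GradedAlgebra 𝒜] [IsNoetherian G N] (𝒢 : ModuleGrading 𝒜 N)
    (K : Submodule G N) {k : ℕ} (hK : ∀ j, k ≤ j → ∀ g ∈ 𝒜 j, ∀ y ∈ K, g • y = 0) :
    ∃ n₀, ∀ n, n₀ ≤ n → ∀ y ∈ K, y ∈ 𝒢.comp n → y = 0 := by
  obtain ⟨S, hS, hspan⟩ := (Submodule.fg_span_iff_fg_span_finset_subset
    (R := G) {y : N | y ∈ K ∧ ∃ n, y ∈ 𝒢.comp n}).mp (IsNoetherian.noetherian _)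
  choose! deg hdeg using fun y (hy : y ∈ (S : Set N)) => (hS hy).2
  refine ⟨S.sup deg + k, fun n hn y hyK hy => ?_⟩
  have hy' : y ∈ Submodule.span G (S : Set N) := hspan ▸ Submodule.subset_span ⟨hyK, n, hy⟩
  obtain ⟨c, -, rfl⟩ := Submodule.mem_span_finset.mp hy'
  rw [← 𝒢.proj_of_mem _ _ hy, map_sum]
  refine Finset.sum_eq_zero fun a ha => ?_
  have hle : deg a ≤ S.sup deg := Finset.le_sup ha
  have h1 : n = (n - deg a) + deg a := by omega
  rw [h1, 𝒢.proj_smul_add (hdeg a ha)]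
  exact hK (n - deg a) (by omega) _ (DirectSum.decompose 𝒜 (c a) _).2 a (hS ha).1

/-- A finite module has a finite homogeneous generating set. -/
theorem exists_finset_span_eq_top [Module.Finite G N] (𝒢 : ModuleGrading 𝒜 N) :
    ∃ S : Finset N, (∀ y ∈ S, ∃ n, y ∈ 𝒢.comp n) ∧ Submodule.span G (S : Set N) = ⊤ := by
  have htop : Submodule.span G {y : N | ∃ n, y ∈ 𝒢.comp n} = ⊤ := by
    refine eq_top_iff.mpr fun x _ => ?_
    induction x using 𝒢.induction_on with
    | h0 => exact zero_mem _
    | hadd x y hx hy => exact add_mem (hx trivial) (hy trivial)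
    | hcomp n x hx => exact Submodule.subset_span ⟨n, hx⟩
  obtain ⟨S, hS, hspan⟩ := (Submodule.fg_span_iff_fg_span_finset_subset
    (R := G) {y : N | ∃ n, y ∈ 𝒢.comp n}).mp (htop ▸ Module.Finite.fg_top)
  exact ⟨S, fun y hy => hS hy, hspan ▸ htop⟩

theorem fg_comp [GradedAlgebra 𝒜] [IsNoetherianRing R] [IsScalarTower R G N] [Module.Finite G N]
    (𝒢 : ModuleGrading 𝒜 N) (h𝒜 : ∀ i, (𝒜 i).FG) (n : ℕ) : (𝒢.comp n).FG := by
  obtain ⟨S, hS, hspan⟩ := 𝒢.exists_finset_span_eq_top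
  choose! deg hdeg using hS
  let φ : N → G →ₗ[R] N := fun y => (LinearMap.toSpanSingleton G N y).restrictScalars R
  have hT : (⨆ y ∈ S, (𝒜 (n - deg y)).map (φ y)).FG :=
    Submodule.fg_biSup S _ fun y _ => (h𝒜 _).map _
  refine Submodule.FG.of_le hT fun x hx => ?_
  obtain ⟨c, -, rfl⟩ := Submodule.mem_span_finset.mp (hspan ▸ Submodule.mem_top : x ∈ _)
  rw [← 𝒢.proj_of_mem _ _ hx, map_sum]
  refine Submodule.sum_mem _ fun a ha => ?_
  rcases lt_or_ge n (deg a) with h | h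
  · rw [𝒢.proj_smul_of_lt (hdeg a ha) h]
    exact zero_mem _
  · have h1 : 𝒢.proj n (c a • a) = (DirectSum.decompose 𝒜 (c a) (n - deg a) : G) • a := by
      rw [← 𝒢.proj_smul_add (hdeg a ha), Nat.sub_add_cancel h]
    rw [h1]
    exact Submodule.mem_iSup_of_mem a (Submodule.mem_iSup_of_mem ha
      ⟨_, (DirectSum.decompose 𝒜 (c a) _).2, rfl⟩)

end Basic

end ModuleGrading

section Length

theorem isArtinian_of_le_annihilator {A M : Type*} [CommRing A] [AddCommGroup M] [Module A M]
    [Module.Finite A M] (I : Ideal A) [IsArtinianRing (A ⧸ I)] (h : I ≤ Module.annihilator A M) :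
    IsArtinian A M := by
  have ht : Module.IsTorsionBySet A M (I : Set A) := fun x a =>
    Module.mem_annihilator.mp (h a.2) x
  let _ : Module (A ⧸ I) M := ht.module
  have : IsScalarTower A (A ⧸ I) M := ht.isScalarTower
  have : Module.Finite (A ⧸ I) M := Module.Finite.of_restrictScalars_finite A (A ⧸ I) M
  exact isArtinian_of_surjective_algebraMap (R := A ⧸ I) (Ideal.Quotient.mk_surjective (I := I))

theorem isArtinianRing_quotient_maximalIdeal_pow (R : Type*) [CommRing R] [IsNoetherianRing R]
    [IsLocalRing R] (k : ℕ) : IsArtinianRing (R ⧸ IsLocalRing.maximalIdeal R ^ (k + 1)) := by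
  refine IsLocalRing.quotient_artinian_of_mem_minimalPrimes_of_isLocalRing _
    ⟨⟨inferInstance, Ideal.pow_le_self (Nat.succ_ne_zero k)⟩, fun q hq _ => ?_⟩
  exact hq.1.le_of_pow_le hq.2

theorem length_ne_top_of_pow_smul_eq_zero {R M : Type*} [CommRing R] [IsNoetherianRing R]
    [IsLocalRing R] [AddCommGroup M] [Module R M] {A : Submodule R M} (hA : A.FG) {k : ℕ}
    (h : ∀ r ∈ IsLocalRing.maximalIdeal R ^ k, ∀ x ∈ A, r • x = 0) :
    Module.length R A ≠ ⊤ := by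
  have : Module.Finite R A := Module.Finite.iff_fg.mpr hA
  have := isArtinianRing_quotient_maximalIdeal_pow R k
  have : IsArtinian R A := isArtinian_of_le_annihilator
    (IsLocalRing.maximalIdeal R ^ (k + 1)) fun r hr => Module.mem_annihilator.mpr fun x =>
      Subtype.ext (h r (Ideal.pow_le_pow_right (Nat.le_succ k) hr) x x.2)
  exact Module.length_ne_top

/-- The length of a submodule, as a natural number. -/
def natLength {R M : Type*} [CommRing R] [AddCommGroup M] [Module R M] (A : Submodule R M) : ℕ :=
  (mLength R A).toNat

theorem natLength_eq_toNat {R M : Type*} [CommRing R] [AddCommGroup M] [Module R M]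
    (A : Submodule R M) : natLength A = (Module.length R A).toNat := by
  rw [natLength, mLength, Module.length_eq_height]

theorem natLength_bot {R M : Type*} [CommRing R] [AddCommGroup M] [Module R M] :
    natLength (⊥ : Submodule R M) = 0 := by
  rw [natLength_eq_toNat, Module.length_bot, ENat.toNat_zero]

theorem length_submodule_mono {R M : Type*} [CommRing R] [AddCommGroup M] [Module R M]
    {A B : Submodule R M} (h : A ≤ B) : Module.length R A ≤ Module.length R B :=
  Module.length_le_of_injective _ (Submodule.inclusion_injective h)

theorem natLength_mono {R M : Type*} [CommRing R] [AddCommGroup M] [Module R M]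
    {A B : Submodule R M} (hB : Module.length R B ≠ ⊤) (h : A ≤ B) :
    natLength A ≤ natLength B := by
  rw [natLength_eq_toNat, natLength_eq_toNat]
  exact ENat.toNat_le_toNat (length_submodule_mono h) hB

theorem natLength_eq_map_add {R M P : Type*} [CommRing R] [AddCommGroup M] [Module R M]
    [AddCommGroup P] [Module R P] (φ : M →ₗ[R] P) {A : Submodule R M}
    (hA : Module.length R A ≠ ⊤) :
    natLength A = natLength (A.map φ) + natLength (A ⊓ LinearMap.ker φ) := by
  have h := Module.length_eq_add_of_exact
    (Submodule.inclusion (inf_le_left : A ⊓ LinearMap.ker φ ≤ A)) (φ.submoduleMap A)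
    (Submodule.inclusion_injective _) (φ.submoduleMap_surjective A) (by
      intro x
      constructor
      · intro hx
        exact ⟨⟨x, x.2, congrArg Subtype.val hx⟩, rfl⟩
      · rintro ⟨y, rfl⟩
        exact Subtype.ext y.2.2)
  rw [h] at hA
  rw [natLength_eq_toNat, natLength_eq_toNat, natLength_eq_toNat, h, add_comm,
    ENat.toNat_add (fun h' => hA (by rw [h', add_top])) (fun h' => hA (by rw [h', top_add]))]

theorem natLength_map_of_injOn {R M P : Type*} [CommRing R] [AddCommGroup M] [Module R M]
    [AddCommGroup P] [Module R P] (φ : M →ₗ[R] P) {A : Submodule R M}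
    (hA : Module.length R A ≠ ⊤) (h : ∀ x ∈ A, φ x = 0 → x = 0) :
    natLength (A.map φ) = natLength A := by
  have : A ⊓ LinearMap.ker φ = ⊥ := (Submodule.eq_bot_iff _).mpr fun x hx => h x hx.1 hx.2
  rw [natLength_eq_map_add φ hA, this, natLength_bot, add_zero]

end Length

section Stolz

open Asymptotics

theorem tendsto_div_choose_iff {e : ℕ} {u : ℕ → ℝ} {c : ℝ} :
    Tendsto (fun n : ℕ => u n / (n.choose e : ℝ)) atTop (nhds c) ↔
      Tendsto (fun n : ℕ => ((e.factorial : ℝ) / (n : ℝ) ^ e) * u n) atTop (nhds c) := by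
  have h1 := isEquivalent_choose e
  have h2 : (fun n : ℕ => u n / (n.choose e : ℝ)) ~[atTop]
      fun n : ℕ => u n / ((n : ℝ) ^ e / (e.factorial : ℝ)) :=
    IsEquivalent.refl.div h1
  rw [h2.tendsto_nhds_iff]
  refine tendsto_congr fun n => ?_
  rw [div_div_eq_mul_div, div_mul_eq_mul_div, mul_comm]

/-- A Stolz–Cesàro lemma for polynomial growth. -/
theorem tendsto_of_tendsto_succ_sub {e : ℕ} {a b : ℕ → ℝ} {c : ℝ}
    (hab : ∀ᶠ n in atTop, a (n + 1) - a n = b (n + 1))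
    (hb : Tendsto (fun n : ℕ => ((e.factorial : ℝ) / (n : ℝ) ^ e) * b n) atTop (nhds c)) :
    Tendsto (fun n : ℕ => (((e + 1).factorial : ℝ) / (n : ℝ) ^ (e + 1)) * a n) atTop (nhds c) := by
  rw [← tendsto_div_choose_iff] at hb ⊢
  have hchoose : ∀ k : ℕ, Tendsto (fun n : ℕ => (n.choose k : ℝ) / ((n + 1).choose k : ℝ)) atTop
      (nhds 1) := by
    intro k
    have h1 : (fun n : ℕ => (n.choose k : ℝ)) ~[atTop] fun n : ℕ => ((n + 1).choose k : ℝ) := by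
      have hA := isEquivalent_choose k
      have hB : (fun n : ℕ => ((n + 1).choose k : ℝ)) ~[atTop]
          fun n : ℕ => (((n + 1 : ℕ) : ℝ) ^ k / (k.factorial : ℝ)) :=
        hA.comp_tendsto (tendsto_add_atTop_nat 1)
      refine (hA.trans ?_).trans hB.symm
      refine IsEquivalent.div ?_ IsEquivalent.refl
      refine IsEquivalent.pow ?_ k
      refine (isEquivalent_iff_tendsto_one ?_).mpr ?_
      · exact Eventually.of_forall fun n => by positivity
      · have := tendsto_natCast_div_add_atTop (1 : ℝ)
        refine this.congr fun n => ?_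
        simp
    refine (isEquivalent_iff_tendsto_one ?_).mp h1
    filter_upwards [eventually_ge_atTop k] with n hn
    exact_mod_cast (Nat.choose_pos (by omega)).ne'
  have hpos : ∀ k : ℕ, ∀ᶠ n : ℕ in atTop, (n.choose k : ℝ) ≠ 0 := fun k => by
    filter_upwards [eventually_ge_atTop k] with n hn
    exact_mod_cast (Nat.choose_pos hn).ne'
  have hb1 : Tendsto (fun n : ℕ => (a (n + 1) - a n) / (n.choose e : ℝ)) atTop (nhds c) := by
    have h1 : Tendsto (fun n : ℕ => b (n + 1) / ((n + 1).choose e : ℝ)) atTop (nhds c) :=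
      hb.comp (tendsto_add_atTop_nat 1)
    have h2 := h1.div (hchoose e) one_ne_zero
    rw [div_one] at h2
    refine h2.congr' ?_
    filter_upwards [hab, hpos e, (tendsto_add_atTop_nat 1).eventually (hpos e)] with n h3 h4 h5
    rw [h3]
    simp only [Pi.div_apply]
    field_simp
  have ho : (fun n : ℕ => (a (n + 1) - a n) - c * (n.choose e : ℝ)) =o[atTop]
      fun n : ℕ => (n.choose e : ℝ) := by
    rw [isLittleO_iff_tendsto' ((hpos e).mono fun n hn h => absurd h hn)]
    have := hb1.sub_const c
    rw [sub_self] at this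
    refine this.congr' ?_
    filter_upwards [hpos e] with n hn
    field_simp
  have hsum : ∀ n : ℕ, ∑ i ∈ Finset.range n, (i.choose e : ℝ) = (n.choose (e + 1) : ℝ) := by
    intro n
    induction n with
    | zero => simp
    | succ n ih => rw [Finset.sum_range_succ, ih, Nat.choose_succ_succ]; push_cast; ring
  have htop : Tendsto (fun n : ℕ => (n.choose (e + 1) : ℝ)) atTop atTop := by
    refine (isEquivalent_choose (e + 1)).symm.tendsto_atTop ?_
    exact ((tendsto_pow_atTop (Nat.succ_ne_zero e)).comp
      tendsto_natCast_atTop_atTop).atTop_div_const (by positivity)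
  have hO := ho.sum_range (fun n => by positivity) (by simpa only [hsum] using htop)
  have h3 : (fun n : ℕ => a n - a 0 - c * (n.choose (e + 1) : ℝ)) =o[atTop]
      fun n : ℕ => (n.choose (e + 1) : ℝ) := by
    refine hO.congr (fun n => ?_) hsum
    rw [Finset.sum_sub_distrib, Finset.sum_range_sub, ← Finset.mul_sum, hsum]
  have h4 :=
    (h3.tendsto_div_nhds_zero.add (tendsto_const_nhds (x := a 0) |>.div_atTop htop)).add_const c
  rw [zero_add, zero_add] at h4
  refine h4.congr' ?_
  filter_upwards [hpos (e + 1)] with n hn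
  field_simp
  ring

end Stolz

section StandardGraded

variable {R G : Type*} [CommRing R] [CommRing G] [Algebra R G] {𝒜 : ℕ → Submodule R G}

theorem pow_le_of_le_ideal {V : Submodule R G} {P : Ideal G} (h : V ≤ P.restrictScalars R)
    (n : ℕ) : V ^ n ≤ (P ^ n).restrictScalars R := by
  induction n with
  | zero => simp
  | succ n ih =>
    rw [pow_succ, Submodule.mul_le]
    intro a ha b hb
    exact pow_succ P n ▸ Ideal.mul_mem_mul (ih ha) (h hb)

theorem ringKrullDim_quotient_le_of_degreeOne_le [GradedAlgebra 𝒜]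
    (hstd : ∀ n : ℕ, 𝒜 n = 𝒜 1 ^ n) {P : Ideal G} (hP : 𝒜 1 ≤ P.restrictScalars R)
    {q : Ideal R} (hq : q ≤ P.comap (algebraMap R G)) :
    ringKrullDim (G ⧸ P) ≤ ringKrullDim (R ⧸ q) := by
  have hsurj : Function.Surjective ((Ideal.Quotient.mk P).comp (algebraMap R G)) := by
    intro y
    obtain ⟨g, rfl⟩ := Ideal.Quotient.mk_surjective y
    induction g using DirectSum.Decomposition.inductionOn 𝒜 with
    | zero => exact ⟨0, by simp⟩
    | @homogeneous j g =>
      obtain ⟨g, hg⟩ := g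
      rcases Nat.eq_zero_or_pos j with rfl | hj
      · rw [hstd, pow_zero, Submodule.mem_one] at hg
        obtain ⟨r, rfl⟩ := hg
        exact ⟨r, rfl⟩
      · refine ⟨0, ?_⟩
        rw [hstd] at hg
        have : g ∈ P := Ideal.pow_le_self hj.ne' (pow_le_of_le_ideal hP j hg)
        rw [map_zero]
        exact (Ideal.Quotient.eq_zero_iff_mem.mpr this).symm
    | add a b ha hb =>
      obtain ⟨r, hr⟩ := ha
      obtain ⟨s, hs⟩ := hb
      exact ⟨r + s, by rw [map_add, hr, hs, map_add]⟩
  refine ringKrullDim_le_of_surjective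
    (Ideal.Quotient.lift q ((Ideal.Quotient.mk P).comp (algebraMap R G)) fun r hr => ?_)
    (Ideal.Quotient.lift_surjective_of_surjective _ _ hsurj)
  exact Ideal.Quotient.eq_zero_iff_mem.mpr (hq hr)

theorem ringKrullDim_quotient_le_zero [IsLocalRing R] [GradedAlgebra 𝒜]
    (hstd : ∀ n : ℕ, 𝒜 n = 𝒜 1 ^ n) {P : Ideal G} (hP : 𝒜 1 ≤ P.restrictScalars R)
    (hq : IsLocalRing.maximalIdeal R ≤ P.comap (algebraMap R G)) :
    ringKrullDim (G ⧸ P) ≤ 0 := by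
  refine (ringKrullDim_quotient_le_of_degreeOne_le hstd hP hq).trans ?_
  exact (ringKrullDim_eq_zero_of_isField
    (Ideal.Quotient.maximal_ideal_iff_isField_quotient _ |>.mp inferInstance)).le

theorem ringKrullDim_quotient_sup_span_singleton_le [IsLocalRing R] [GradedAlgebra 𝒜]
    (hstd : ∀ n : ℕ, 𝒜 n = 𝒜 1 ^ n) {I : Ideal G}
    (hI : ∀ P : Ideal G, P.IsPrime → I ≤ P →
      IsLocalRing.maximalIdeal R ≤ P.comap (algebraMap R G)) {f : G}
    (hf : ∀ P ∈ I.minimalPrimes, ¬ 𝒜 1 ≤ P.restrictScalars R → f ∉ P) {e : ℕ}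
    (hdim : ringKrullDim (G ⧸ I) ≤ ((e + 1 : ℕ) : WithBot ℕ∞)) :
    ringKrullDim (G ⧸ (I ⊔ Ideal.span {f})) ≤ (e : WithBot ℕ∞) := by
  refine ringKrullDim_quotient_le_of_minimalPrimes le_sup_left hdim fun P hP hle => ?_
  have h1 : 𝒜 1 ≤ P.restrictScalars R := by
    by_contra h
    exact hf P hP h (hle (Ideal.mem_sup_right (Ideal.mem_span_singleton_self f)))
  refine (ringKrullDim_quotient_le_zero hstd h1 (hI P hP.1.1 hP.1.2)).trans ?_
  exact_mod_cast Nat.zero_le e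

end StandardGraded

namespace ModuleGrading

section Growth

variable {R G : Type*} [CommRing R] [CommRing G] [Algebra R G]
    {𝒜 : ℕ → Submodule R G} {N : Type*} [AddCommGroup N] [Module R N] [Module G N]

/-- A degree one element avoiding the relevant associated primes is injective in large degrees. -/
theorem exists_forall_ge_smul_eq_zero [IsNoetherianRing G] [GradedAlgebra 𝒜] [Module.Finite G N]
    (𝒢 : ModuleGrading 𝒜 N) (hstd : ∀ n : ℕ, 𝒜 n = 𝒜 1 ^ n) {f : G}
    (hf : ∀ P ∈ associatedPrimes G N, ¬ 𝒜 1 ≤ P.restrictScalars R → f ∉ P) :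
    ∃ n₀, ∀ n, n₀ ≤ n → ∀ y ∈ 𝒢.comp n, f • y = 0 → y = 0 := by
  set K : Submodule G N := Submodule.torsionBy G N f with hK
  have hrad : Ideal.span (𝒜 1 : Set G) ≤ (Module.annihilator G K).radical := by
    rw [← Ideal.sInf_minimalPrimes]
    refine le_sInf fun P hP => Ideal.span_le.mpr ?_
    have hass : P ∈ associatedPrimes G N := associatedPrimes.subset_of_injective
      K.subtype_injective
      (Module.associatedPrimes.minimalPrimes_annihilator_subset_associatedPrimes G K hP)
    have hfP : f ∈ P := hP.1.2 (Module.mem_annihilator.mpr fun x => Subtype.ext x.2)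
    by_contra h
    exact hf P hass h hfP
  obtain ⟨k, hk⟩ := Ideal.exists_pow_le_of_le_radical_of_fg hrad
    (IsNoetherian.noetherian _)
  obtain ⟨n₀, h₀⟩ := 𝒢.exists_forall_ge_eq_zero K (k := k) fun j hj g hg y hy => by
    rw [hstd] at hg
    have hV : 𝒜 1 ≤ (Ideal.span (𝒜 1 : Set G)).restrictScalars R := fun x hx =>
      Ideal.subset_span (s := (𝒜 1 : Set G)) hx
    have h1 : g ∈ Ideal.span (𝒜 1 : Set G) ^ j := pow_le_of_le_ideal hV j hg
    have h2 := Module.mem_annihilator.mp (hk (Ideal.pow_le_pow_right hj h1)) ⟨y, hy⟩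
    exact congrArg Subtype.val h2
  exact ⟨n₀, fun n hn y hy hfy => h₀ n hn y hfy hy⟩

theorem exists_forall_ge_comp_eq_bot [IsNoetherianRing G] [GradedAlgebra 𝒜] [Module.Finite G N]
    (𝒢 : ModuleGrading 𝒜 N) {I : Ideal G} (hI : I ≤ Module.annihilator G N)
    (hdim : ringKrullDim (G ⧸ I) ≤ 0) : ∃ n₀, ∀ n, n₀ ≤ n → 𝒢.comp n = ⊥ := by
  have : Ring.KrullDimLE 0 (G ⧸ I) := by
    rw [Ring.KrullDimLE, Order.krullDimLE_iff]
    exact_mod_cast hdim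
  have : IsArtinianRing (G ⧸ I) := IsNoetherianRing.isArtinianRing_of_krullDimLE_zero
  have : IsArtinian G N := isArtinian_of_le_annihilator I hI
  let F : ℕ →o (Submodule G N)ᵒᵈ :=
    { toFun := fun n => OrderDual.toDual (Submodule.span G {y | ∃ m, n ≤ m ∧ y ∈ 𝒢.comp m})
      monotone' := fun a b hab => OrderDual.toDual_le_toDual.mpr (Submodule.span_mono
        fun y ⟨m, hm, hy⟩ => ⟨m, hab.trans hm, hy⟩) }
  obtain ⟨n₀, h₀⟩ := IsArtinian.monotone_stabilizes F
  refine ⟨n₀, fun n hn => (Submodule.eq_bot_iff _).mpr fun x hx => ?_⟩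
  have h1 : x ∈ Submodule.span G {y | ∃ m, n ≤ m ∧ y ∈ 𝒢.comp m} :=
    Submodule.subset_span ⟨n, le_rfl, hx⟩
  have h2 : Submodule.span G {y | ∃ m, n ≤ m ∧ y ∈ 𝒢.comp m} =
      Submodule.span G {y | ∃ m, n + 1 ≤ m ∧ y ∈ 𝒢.comp m} :=
    (h₀ n hn).symm.trans (h₀ (n + 1) (by omega))
  rw [h2] at h1
  have h3 : ∀ m, m < n + 1 → 𝒢.proj m x = 0 := by
    clear hx h2
    induction h1 using Submodule.span_induction with
    | mem y hy =>
      obtain ⟨j, hj, hy⟩ := hy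
      exact fun m hm => 𝒢.proj_of_mem_ne _ _ _ hy (by omega)
    | zero => simp
    | add y z _ _ hy hz => exact fun m hm => by rw [map_add, hy m hm, hz m hm, add_zero]
    | smul g y _ hy =>
      intro m hm
      obtain ⟨s, hs⟩ := 𝒢.sum_proj y
      rw [← hs, Finset.smul_sum, map_sum]
      refine Finset.sum_eq_zero fun i _ => ?_
      rcases lt_or_ge i (n + 1) with h | h
      · rw [hy i h, smul_zero, map_zero]
      · exact 𝒢.proj_smul_of_lt (𝒢.proj_mem i y) (by omega) g
  rw [← 𝒢.proj_of_mem n x hx, h3 n (Nat.lt_succ_self n)]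

theorem sup_span_singleton_le_annihilator {I : Ideal G} (hI : I ≤ Module.annihilator G N) (f : G) :
    I ⊔ Ideal.span {f} ≤
      Module.annihilator G (N ⧸ (Ideal.span {f} • ⊤ : Submodule G N)) := by
  refine sup_le (fun g hg => Module.mem_annihilator.mpr fun y => ?_)
    ((Ideal.span_singleton_le_iff_mem _).mpr (Module.mem_annihilator.mpr fun y => ?_))
  · obtain ⟨y, rfl⟩ := Submodule.mkQ_surjective _ y
    rw [← map_smul, Module.mem_annihilator.mp (hI hg) y, map_zero]
  · obtain ⟨y, rfl⟩ := Submodule.mkQ_surjective _ y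
    rw [← map_smul, Submodule.mkQ_apply, Submodule.Quotient.mk_eq_zero]
    exact mem_span_smul_top.mpr ⟨y, rfl⟩

theorem proj_smul_of_mem (𝒢 : ModuleGrading 𝒜 N) {f : G} {i : ℕ} (hf : f ∈ 𝒜 i) (x : N) (n : ℕ) :
    𝒢.proj (i + n) (f • x) = f • 𝒢.proj n x := by
  induction x using 𝒢.induction_on with
  | h0 => simp
  | hadd x y hx hy => rw [smul_add, map_add, hx, hy, map_add, smul_add]
  | hcomp m x hx =>
    by_cases h : m = n
    · subst h
      rw [𝒢.proj_of_mem _ _ (𝒢.smul_mem _ _ _ _ hf hx), 𝒢.proj_of_mem _ _ hx]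
    · rw [𝒢.proj_of_mem_ne _ _ _ (𝒢.smul_mem _ _ _ _ hf hx) (by omega),
        𝒢.proj_of_mem_ne _ _ _ hx h, smul_zero]

/-- Lengths of consecutive components of a submodule `W` on which `f` acts injectively, when
`f` is also injective modulo `W`, both in the relevant degree. -/
theorem natLength_succ_eq [IsScalarTower R G N] (𝒢 : ModuleGrading 𝒜 N) {f : G} (hf : f ∈ 𝒜 1)
    (W : Submodule G N) {n : ℕ}
    (hfin : ∀ j, Module.length R (W.restrictScalars R ⊓ 𝒢.comp j : Submodule R N) ≠ ⊤)
    (hinj : ∀ y ∈ W, y ∈ 𝒢.comp n → f • y = 0 → y = 0)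
    (hcolon : ∀ y ∈ 𝒢.comp n, f • y ∈ W → y ∈ W) :
    natLength (W.restrictScalars R ⊓ 𝒢.comp (n + 1)) =
      natLength ((W.restrictScalars R ⊓ 𝒢.comp (n + 1)).map
        ((Ideal.span {f} • ⊤ : Submodule G N).mkQ.restrictScalars R)) +
      natLength (W.restrictScalars R ⊓ 𝒢.comp n) := by
  rw [natLength_eq_map_add ((Ideal.span {f} • ⊤ : Submodule G N).mkQ.restrictScalars R)
    (hfin (n + 1))]
  congr 1
  let φ : N →ₗ[R] N := (LinearMap.lsmul G N f).restrictScalars R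
  rw [← natLength_map_of_injOn φ (hfin n) fun x hx => hinj x hx.1 hx.2]
  congr 1
  ext x
  simp only [Submodule.mem_inf, LinearMap.mem_ker, Submodule.mem_map,
    Submodule.restrictScalars_mem, LinearMap.coe_restrictScalars, Submodule.mkQ_apply,
    Submodule.Quotient.mk_eq_zero, mem_span_smul_top]
  constructor
  · rintro ⟨⟨hxW, hx⟩, y, rfl⟩
    have h1 : f • y = f • 𝒢.proj n y := by
      rw [← 𝒢.proj_smul_of_mem hf, add_comm 1 n, 𝒢.proj_of_mem _ _ hx]
    refine ⟨𝒢.proj n y, ⟨hcolon _ (𝒢.proj_mem n y) (h1 ▸ hxW), 𝒢.proj_mem n y⟩, h1.symm⟩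
  · rintro ⟨y, ⟨hyW, hy⟩, rfl⟩
    exact ⟨⟨W.smul_mem f hyW, add_comm 1 n ▸ 𝒢.smul_mem 1 n f y hf hy⟩, y, rfl⟩

theorem natLength_comp_succ_eq [IsScalarTower R G N] (𝒢 : ModuleGrading 𝒜 N) {f : G}
    (hf : f ∈ 𝒜 1) {n : ℕ} (hfin : ∀ j, Module.length R (𝒢.comp j) ≠ ⊤)
    (hinj : ∀ y ∈ 𝒢.comp n, f • y = 0 → y = 0) :
    natLength (𝒢.comp (n + 1)) =
      natLength ((𝒢.quotient _ (𝒢.isHomog_span_smul_top hf)).comp (n + 1)) +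
      natLength (𝒢.comp n) := by
  have h := 𝒢.natLength_succ_eq hf ⊤ (n := n)
    (fun j => by rw [Submodule.restrictScalars_top, top_inf_eq]; exact hfin j)
    (fun y _ hy => hinj y hy) (fun _ _ _ => trivial)
  simp only [Submodule.restrictScalars_top, top_inf_eq] at h
  exact h

theorem length_comp_ne_top [IsNoetherianRing R] [IsLocalRing R] [GradedAlgebra 𝒜]
    [IsScalarTower R G N] [Module.Finite G N] (𝒢 : ModuleGrading 𝒜 N)
    (h𝒜 : ∀ i, (𝒜 i).FG) {k : ℕ}
    (hk : ∀ r ∈ IsLocalRing.maximalIdeal R ^ k, ∀ x : N, r • x = 0) (n : ℕ) :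
    Module.length R (𝒢.comp n) ≠ ⊤ :=
  length_ne_top_of_pow_smul_eq_zero (𝒢.fg_comp h𝒜 n) fun r hr x _ => hk r hr x

end Growth

end ModuleGrading

namespace ModuleGrading

section HilbertGrowth

variable {R G : Type*} [CommRing R] [IsNoetherianRing R] [IsLocalRing R]
    [CommRing G] [IsNoetherianRing G] [Algebra R G] {𝒜 : ℕ → Submodule R G} [GradedAlgebra 𝒜]

theorem exists_natLength_comp_succ_eq [Infinite (IsLocalRing.ResidueField R)]
    (hstd : ∀ n : ℕ, 𝒜 n = 𝒜 1 ^ n) (h𝒜 : ∀ i, (𝒜 i).FG) {N : Type*} [AddCommGroup N]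
    [Module R N] [Module G N] [IsScalarTower R G N] [Module.Finite G N]
    (𝒢 : ModuleGrading 𝒜 N) {I : Ideal G} {k e : ℕ} (hI : I ≤ Module.annihilator G N)
    (hk : ∀ r ∈ IsLocalRing.maximalIdeal R ^ k, algebraMap R G r ∈ I)
    (hdim : ringKrullDim (G ⧸ I) ≤ ((e + 1 : ℕ) : WithBot ℕ∞)) :
    ∃ (f : G) (hf : f ∈ 𝒜 1),
      ringKrullDim (G ⧸ (I ⊔ Ideal.span {f})) ≤ (e : WithBot ℕ∞) ∧
      ∀ᶠ n in atTop, natLength (𝒢.comp (n + 1)) =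
        natLength ((𝒢.quotient _ (𝒢.isHomog_span_smul_top hf)).comp (n + 1)) +
        natLength (𝒢.comp n) := by
  let T : Set (Ideal G) := {P | P ∈ associatedPrimes G N ∪ I.minimalPrimes ∧
    ¬ 𝒜 1 ≤ P.restrictScalars R}
  have hT : T.Finite := ((associatedPrimes.finite G N).union
    (Ideal.finite_minimalPrimes_of_isNoetherianRing G I)).subset fun P hP => hP.1
  obtain ⟨f, hf, hfT⟩ := exists_mem_forall_notMem (h𝒜 1)
    (hT.image (Submodule.restrictScalars R)) (by rintro _ ⟨P, hP, rfl⟩; exact hP.2)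
  have hfP : ∀ P ∈ associatedPrimes G N ∪ I.minimalPrimes, ¬ 𝒜 1 ≤ P.restrictScalars R → f ∉ P :=
    fun P hP h => hfT _ ⟨P, ⟨hP, h⟩, rfl⟩
  refine ⟨f, hf, ?_, ?_⟩
  · refine ringKrullDim_quotient_sup_span_singleton_le hstd (fun P hP hIP r hr => ?_)
      (fun P hP => hfP P (Or.inr hP)) hdim
    have := hIP (hk (r ^ k) (Ideal.pow_mem_pow hr k))
    rw [map_pow] at this
    exact hP.mem_of_pow_mem k this
  · obtain ⟨n₀, h₀⟩ := 𝒢.exists_forall_ge_smul_eq_zero hstd fun P hP => hfP P (Or.inl hP)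
    filter_upwards [Filter.eventually_ge_atTop n₀] with n hn
    refine 𝒢.natLength_comp_succ_eq hf (𝒢.length_comp_ne_top h𝒜 (k := k) fun r hr x => ?_) (h₀ n hn)
    rw [← algebraMap_smul G r x]
    exact Module.mem_annihilator.mp (hI (hk r hr)) x

/-- Components of a graded module over `G ⧸ I`, `dim G ⧸ I ≤ e + 1`, whose degree zero part is
Artinian, have lengths growing like a multiple of `n ^ e / e!`. -/
theorem exists_tendsto_natLength_comp [Infinite (IsLocalRing.ResidueField R)]
    (hstd : ∀ n : ℕ, 𝒜 n = 𝒜 1 ^ n) (h𝒜 : ∀ i, (𝒜 i).FG) (e : ℕ) :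
    ∀ {N : Type*} [AddCommGroup N] [Module R N] [Module G N] [IsScalarTower R G N]
      [Module.Finite G N] (𝒢 : ModuleGrading 𝒜 N) {I : Ideal G} {k : ℕ},
      I ≤ Module.annihilator G N →
      (∀ r ∈ IsLocalRing.maximalIdeal R ^ k, algebraMap R G r ∈ I) →
      ringKrullDim (G ⧸ I) ≤ ((e + 1 : ℕ) : WithBot ℕ∞) →
      ∃ c : ℝ, Tendsto (fun n : ℕ => ((e.factorial : ℝ) / (n : ℝ) ^ e) *
        (natLength (𝒢.comp n) : ℝ)) atTop (nhds c) := by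
  induction e with
  | zero =>
    intro N _ _ _ _ _ 𝒢 I k hI hk hdim
    obtain ⟨f, hf, hdim', hev⟩ := 𝒢.exists_natLength_comp_succ_eq hstd h𝒜 hI hk hdim
    obtain ⟨n₁, h₁⟩ := (𝒢.quotient _ (𝒢.isHomog_span_smul_top hf)).exists_forall_ge_comp_eq_bot
      (sup_span_singleton_le_annihilator hI f) (by exact_mod_cast hdim')
    obtain ⟨n₀, h₀⟩ := Filter.eventually_atTop.mp hev
    have hconst : ∀ n, max n₀ n₁ ≤ n →
        natLength (𝒢.comp n) = natLength (𝒢.comp (max n₀ n₁)) := fun n hn => by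
      induction n, hn using Nat.le_induction with
      | base => rfl
      | succ n hn ihn =>
        rw [h₀ n (by omega), h₁ (n + 1) (by omega), natLength_bot, zero_add, ihn]
    refine ⟨natLength (𝒢.comp (max n₀ n₁)), tendsto_const_nhds.congr' ?_⟩
    filter_upwards [Filter.eventually_ge_atTop (max n₀ n₁)] with n hn
    rw [hconst n hn]
    simp
  | succ e ih =>
    intro N _ _ _ _ _ 𝒢 I k hI hk hdim
    obtain ⟨f, hf, hdim', hev⟩ := 𝒢.exists_natLength_comp_succ_eq hstd h𝒜 hI hk hdim
    obtain ⟨c, hc⟩ := ih (𝒢.quotient _ (𝒢.isHomog_span_smul_top hf))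
      (sup_span_singleton_le_annihilator hI f) (fun r hr => Ideal.mem_sup_left (hk r hr)) hdim'
    refine ⟨c, tendsto_of_tendsto_succ_sub (hev.mono fun n hn => ?_) hc⟩
    rw [hn]
    push_cast
    ring

theorem tendsto_natLength_comp_zero [Infinite (IsLocalRing.ResidueField R)]
    (hstd : ∀ n : ℕ, 𝒜 n = 𝒜 1 ^ n) (h𝒜 : ∀ i, (𝒜 i).FG) (e : ℕ)
    {N : Type*} [AddCommGroup N] [Module R N] [Module G N] [IsScalarTower R G N]
    [Module.Finite G N] (𝒢 : ModuleGrading 𝒜 N) {I : Ideal G} {k : ℕ}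
    (hI : I ≤ Module.annihilator G N)
    (hk : ∀ r ∈ IsLocalRing.maximalIdeal R ^ k, algebraMap R G r ∈ I)
    (hdim : ringKrullDim (G ⧸ I) ≤ (e : WithBot ℕ∞)) :
    Tendsto (fun n : ℕ => ((e.factorial : ℝ) / (n : ℝ) ^ e) *
      (natLength (𝒢.comp n) : ℝ)) atTop (nhds 0) := by
  cases e with
  | zero =>
    obtain ⟨n₀, h₀⟩ := 𝒢.exists_forall_ge_comp_eq_bot hI (by exact_mod_cast hdim)
    refine tendsto_const_nhds.congr' ?_
    filter_upwards [Filter.eventually_ge_atTop n₀] with n hn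
    rw [h₀ n hn, natLength_bot]
    simp
  | succ e =>
    obtain ⟨c, hc⟩ := exists_tendsto_natLength_comp hstd h𝒜 e 𝒢 hI hk hdim
    have h0 : Tendsto (fun n : ℕ => ((e + 1 : ℕ) : ℝ) / (n : ℝ)) atTop (nhds 0) :=
      tendsto_const_div_atTop_nhds_zero_nat _
    have h := h0.mul hc
    rw [zero_mul] at h
    refine h.congr fun n => ?_
    rw [Nat.factorial_succ, pow_succ', ← mul_assoc, div_mul_div_comm, Nat.cast_mul]

end HilbertGrowth

end ModuleGrading

section TorsionPart

variable {R G : Type*} [CommRing R] [CommRing G] [Algebra R G]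
    {N : Type*} [AddCommGroup N] [Module R N] [Module G N] [IsScalarTower R G N]

theorem mem_H0_map_iff (I : Ideal R) {x : N} :
    x ∈ H0 (I.map (algebraMap R G)) N ↔ ∃ k : ℕ, ∀ r ∈ I ^ k, r • x = 0 := by
  have hmono : Monotone fun n : ℕ => Submodule.torsionBySet G N
      ((I.map (algebraMap R G) ^ n : Ideal G) : Set G) := fun a b hab =>
    Submodule.torsionBySet_le_torsionBySet_of_subset (Ideal.pow_le_pow_right hab)
  rw [H0, Submodule.mem_iSup_of_directed _ hmono.directed_le]
  refine exists_congr fun k => ?_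
  rw [← Ideal.map_pow, Ideal.map, ← Submodule.torsionBySet_eq_torsionBySet_span,
    Submodule.mem_torsionBySet_iff]
  constructor
  · intro h r hr
    exact (algebraMap_smul G r x).symm.trans (h ⟨algebraMap R G r, r, hr, rfl⟩)
  · rintro h ⟨_, r, hr, rfl⟩
    exact (algebraMap_smul G r x).trans (h r hr)

theorem exists_pow_smul_H0_eq_zero [IsNoetherianRing G] [Module.Finite G N] (I : Ideal R) :
    ∃ k : ℕ, ∀ r ∈ I ^ k, ∀ x ∈ H0 (I.map (algebraMap R G)) N, r • x = 0 := by
  let F : ℕ →o Submodule G N :=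
    { toFun := fun n => Submodule.torsionBySet G N
        ((I.map (algebraMap R G) ^ n : Ideal G) : Set G)
      monotone' := fun a b hab =>
        Submodule.torsionBySet_le_torsionBySet_of_subset (Ideal.pow_le_pow_right hab) }
  obtain ⟨k, hk⟩ := monotone_stabilizes_iff_noetherian.mpr
    (inferInstance : IsNoetherian G N) F
  refine ⟨k, fun r hr x hx => ?_⟩
  have hle : H0 (I.map (algebraMap R G)) N ≤ F k := iSup_le fun n => by
    rcases le_total n k with h | h
    · exact F.monotone h
    · exact (hk n h).ge
  exact (algebraMap_smul G r x).symm.trans ((Submodule.mem_torsionBySet_iff _ _).mp (hle hx)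
    ⟨algebraMap R G r, by rw [← Ideal.map_pow]; exact Ideal.mem_map_of_mem _ hr⟩)

theorem not_map_le_of_mem_associatedPrimes_quotient_H0 [IsNoetherianRing G]
    [Module.Finite G N] (I : Ideal R) {P : Ideal G}
    (hP : P ∈ associatedPrimes G (N ⧸ H0 (I.map (algebraMap R G)) N)) :
    ¬ I.map (algebraMap R G) ≤ P := by
  intro hle
  obtain ⟨hprime, y, hy⟩ := (isAssociatedPrime_iff).mp hP
  obtain ⟨x, rfl⟩ := Submodule.mkQ_surjective _ y
  obtain ⟨k, hk⟩ := exists_pow_smul_H0_eq_zero (G := G) (N := N) I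
  have hx : x ∈ H0 (I.map (algebraMap R G)) N := by
    refine (mem_H0_map_iff I).mpr ⟨k + 1, fun r hr => ?_⟩
    rw [pow_succ] at hr
    induction hr using Submodule.mul_induction_on' with
    | mem_mul_mem a ha b hb =>
      rw [mul_smul]
      refine hk a ha _ ?_
      have hb' : algebraMap R G b ∈ P := hle (Ideal.mem_map_of_mem _ hb)
      rw [hy, Submodule.mem_colon_singleton, Submodule.mem_bot, ← map_smul,
        Submodule.mkQ_apply, Submodule.Quotient.mk_eq_zero, algebraMap_smul] at hb'
      exact hb'
    | add a _ b _ ha hb => rw [add_smul, ha, hb, add_zero]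
  apply hprime.ne_top
  rw [hy, Submodule.mkQ_apply, (Submodule.Quotient.mk_eq_zero _).mpr hx, Ideal.eq_top_iff_one,
    Submodule.mem_colon_singleton]
  simp

theorem map_H0_le {P : Type*} [AddCommGroup P] [Module R P] [Module G P] [IsScalarTower R G P]
    (I : Ideal R) (φ : N →ₗ[G] P) :
    (H0 (I.map (algebraMap R G)) N).map φ ≤ H0 (I.map (algebraMap R G)) P := by
  rintro _ ⟨x, hx, rfl⟩
  obtain ⟨k, hk⟩ := (mem_H0_map_iff I).mp hx
  exact (mem_H0_map_iff I).mpr ⟨k, fun r hr => by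
    rw [← algebraMap_smul G, ← map_smul, algebraMap_smul, hk r hr, map_zero]⟩

theorem ModuleGrading.isHomog_H0 {𝒜 : ℕ → Submodule R G} [GradedAlgebra 𝒜]
    (𝒢 : ModuleGrading 𝒜 N) (I : Ideal R) : 𝒢.IsHomog (H0 (I.map (algebraMap R G)) N) := by
  intro x hx n
  obtain ⟨k, hk⟩ := (mem_H0_map_iff I).mp hx
  refine (mem_H0_map_iff I).mpr ⟨k, fun r hr => ?_⟩
  rw [← 𝒢.proj_smul, hk r hr, map_zero]

end TorsionPart

theorem natLength_map_of_injective {R M P : Type*} [CommRing R] [AddCommGroup M] [Module R M]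
    [AddCommGroup P] [Module R P] (φ : M →ₗ[R] P) (hφ : Function.Injective φ)
    (A : Submodule R M) : natLength (A.map φ) = natLength A := by
  rw [natLength_eq_toNat, natLength_eq_toNat, (Submodule.equivMapOfInjective φ hφ A).length_eq]

section DimensionDrop

variable {R G : Type*} [CommRing R] [CommRing G] [Algebra R G] {𝒜 : ℕ → Submodule R G}
    {N : Type*} [AddCommGroup N] [Module R N] [Module G N]

/-- A prime in the support containing `𝒜 1` has dimension at most that of a component. -/
theorem ModuleGrading.exists_ringKrullDim_quotient_le [GradedAlgebra 𝒜] [IsScalarTower R G N]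
    [Module.Finite G N] (𝒢 : ModuleGrading 𝒜 N) (hstd : ∀ n : ℕ, 𝒜 n = 𝒜 1 ^ n)
    {P : Ideal G} (hprime : P.IsPrime) (hann : Module.annihilator G N ≤ P)
    (hP : 𝒜 1 ≤ P.restrictScalars R) :
    ∃ n, ringKrullDim (G ⧸ P) ≤ mDim R (𝒢.comp n) := by
  obtain ⟨S, hS, hspan⟩ := 𝒢.exists_finset_span_eq_top
  have hinf : S.inf (fun y => LinearMap.ker (LinearMap.toSpanSingleton G N y)) ≤ P := by
    refine le_trans (fun g hg => Module.mem_annihilator.mpr fun x => ?_) hann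
    have hx : x ∈ Submodule.span G (S : Set N) := hspan ▸ Submodule.mem_top
    induction hx using Submodule.span_induction with
    | mem y hy =>
      have := (Submodule.mem_finsetInf.mp hg) y hy
      rwa [LinearMap.mem_ker, LinearMap.toSpanSingleton_apply] at this
    | zero => exact smul_zero g
    | add y z _ _ hy hz => rw [smul_add, hy, hz, add_zero]
    | smul a y _ hy => rw [smul_comm, hy, smul_zero]
  obtain ⟨y, hyS, hy⟩ := (Ideal.IsPrime.inf_le' hprime).mp hinf
  obtain ⟨n, hn⟩ := hS y hyS
  refine ⟨n, ringKrullDim_quotient_le_of_degreeOne_le hstd hP fun r hr => hy ?_⟩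
  rw [LinearMap.mem_ker, LinearMap.toSpanSingleton_apply, algebraMap_smul]
  exact congrArg Subtype.val (Module.mem_annihilator.mp hr ⟨y, hn⟩)

theorem ModuleGrading.mDim_quotient_le [GradedAlgebra 𝒜] [IsScalarTower R G N]
    [Module.Finite G N] (𝒢 : ModuleGrading 𝒜 N) (hstd : ∀ n : ℕ, 𝒜 n = 𝒜 1 ^ n) {e : ℕ}
    (hdim : mDim G N ≤ ((e + 1 : ℕ) : WithBot ℕ∞))
    (hcomp : ∀ n, mDim R (𝒢.comp n) < mDim G N) {f : G}
    (hf : ∀ P ∈ (Module.annihilator G N).minimalPrimes, ¬ 𝒜 1 ≤ P.restrictScalars R → f ∉ P) :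
    mDim G (N ⧸ (Ideal.span {f} • ⊤ : Submodule G N)) ≤ (e : WithBot ℕ∞) := by
  have hle := sup_span_singleton_le_annihilator (N := N) le_rfl f
  refine (ringKrullDim_quotient_le_of_forall_isPrime fun P _ hP => hle.trans hP).trans ?_
  refine ringKrullDim_quotient_le_of_minimalPrimes le_sup_left hdim fun P hP hle => ?_
  have h1 : 𝒜 1 ≤ P.restrictScalars R := by
    by_contra h
    exact hf P hP h (hle (Ideal.mem_sup_right (Ideal.mem_span_singleton_self f)))
  obtain ⟨n, hn⟩ := 𝒢.exists_ringKrullDim_quotient_le hstd hP.1.1 hP.1.2 h1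
  have := (hn.trans_lt (hcomp n)).trans_le hdim
  rw [Nat.cast_add, Nat.cast_one] at this
  exact ENat.WithBot.lt_add_one_iff.mp this

end DimensionDrop

namespace ModuleGrading

variable {R G : Type*} [CommRing R] [CommRing G] [Algebra R G] {𝒜 : ℕ → Submodule R G}
    {N : Type*} [AddCommGroup N] [Module R N] [Module G N] [IsScalarTower R G N]

theorem natLength_sub_comp (𝒢 : ModuleGrading 𝒜 N) (W : Submodule G N) (hW : 𝒢.IsHomog W)
    (n : ℕ) :
    natLength ((𝒢.sub W hW).comp n) = natLength (W.restrictScalars R ⊓ 𝒢.comp n) := by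
  rw [← natLength_map_of_injective (W.subtype.restrictScalars R) W.subtype_injective]
  congr 1
  ext x
  constructor
  · rintro ⟨y, hy, rfl⟩
    exact ⟨y.2, hy⟩
  · rintro ⟨hx, hx'⟩
    exact ⟨⟨x, hx⟩, hx', rfl⟩

theorem map_mkQ_inf_comp (𝒢 : ModuleGrading 𝒜 N) {K W : Submodule G N} (hK : 𝒢.IsHomog K)
    (hW : 𝒢.IsHomog W) (n : ℕ) :
    (W.map K.mkQ).restrictScalars R ⊓ (𝒢.quotient K hK).comp n =
      (W.restrictScalars R ⊓ 𝒢.comp n).map (K.mkQ.restrictScalars R) := by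
  ext z
  constructor
  · rintro ⟨⟨w, hw, rfl⟩, hz⟩
    refine ⟨𝒢.proj n w, ⟨hW w hw n, 𝒢.proj_mem n w⟩, ?_⟩
    exact (𝒢.quotient K hK).proj_of_mem n _ hz
  · rintro ⟨w, ⟨hw, hw'⟩, rfl⟩
    exact ⟨⟨w, hw, rfl⟩, ⟨w, hw', rfl⟩⟩

variable [IsNoetherianRing R] [IsLocalRing R] [IsNoetherianRing G] [GradedAlgebra 𝒜]
    [Module.Finite G N]

open IsLocalRing in
theorem length_H0_inf_comp_ne_top (𝒢 : ModuleGrading 𝒜 N) (h𝒜 : ∀ i, (𝒜 i).FG) (n : ℕ) :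
    Module.length R ((H0 ((maximalIdeal R).map (algebraMap R G)) N).restrictScalars R ⊓
      𝒢.comp n : Submodule R N) ≠ ⊤ := by
  obtain ⟨k, hk⟩ := exists_pow_smul_H0_eq_zero (G := G) (N := N) (maximalIdeal R)
  exact length_ne_top_of_pow_smul_eq_zero ((𝒢.fg_comp h𝒜 n).of_le inf_le_right)
    fun r hr x hx => hk r hr x hx.1

open IsLocalRing in
/-- Passing to the quotient by a homogeneous submodule contained in the torsion part. -/
theorem natLength_H0_inf_comp_le (𝒢 : ModuleGrading 𝒜 N) (h𝒜 : ∀ i, (𝒜 i).FG)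
    {W : Submodule G N} (hW : 𝒢.IsHomog W) (n : ℕ) :
    natLength ((H0 ((maximalIdeal R).map (algebraMap R G)) N).restrictScalars R ⊓ 𝒢.comp n) ≤
      natLength ((H0 ((maximalIdeal R).map (algebraMap R G)) (N ⧸ W)).restrictScalars R ⊓
        (𝒢.quotient W hW).comp n) +
      natLength ((H0 ((maximalIdeal R).map (algebraMap R G)) N ⊓ W).restrictScalars R ⊓
        𝒢.comp n) := by
  rw [natLength_eq_map_add (W.mkQ.restrictScalars R) (𝒢.length_H0_inf_comp_ne_top h𝒜 n)]
  refine add_le_add (natLength_mono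
    ((𝒢.quotient W hW).length_H0_inf_comp_ne_top h𝒜 n) ?_) (le_of_eq ?_)
  · rintro _ ⟨x, ⟨hx, hx'⟩, rfl⟩
    exact ⟨map_H0_le _ W.mkQ ⟨x, hx, rfl⟩, ⟨x, hx', rfl⟩⟩
  · congr 1
    ext x
    simp only [Submodule.mem_inf, LinearMap.mem_ker, Submodule.restrictScalars_mem,
      LinearMap.coe_restrictScalars, Submodule.mkQ_apply, Submodule.Quotient.mk_eq_zero]
    tauto

end ModuleGrading

section GeneralElement

variable {R G : Type*} [CommRing R] [CommRing G] [Algebra R G] {𝒜 : ℕ → Submodule R G}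

/-- The primes that a general degree one element has to avoid (unless they contain `𝒜 1`). -/
def criticalPrimes (𝔪 : Ideal G) (N : Type*) [AddCommGroup N] [Module G N] : Set (Ideal G) :=
  associatedPrimes G (H0 𝔪 N) ∪ associatedPrimes G (N ⧸ H0 𝔪 N) ∪
    (Module.annihilator G N).minimalPrimes ∪ (Module.annihilator G N ⊔ 𝔪).minimalPrimes ∪
    (Module.annihilator G (N ⧸ H0 𝔪 N) ⊔ 𝔪).minimalPrimes

theorem finite_criticalPrimes [IsNoetherianRing G] (𝔪 : Ideal G) (N : Type*) [AddCommGroup N]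
    [Module G N] [Module.Finite G N] : (criticalPrimes 𝔪 N).Finite :=
  ((((associatedPrimes.finite G _).union (associatedPrimes.finite G _)).union
    (Ideal.finite_minimalPrimes_of_isNoetherianRing G _)).union
    (Ideal.finite_minimalPrimes_of_isNoetherianRing G _)).union
    (Ideal.finite_minimalPrimes_of_isNoetherianRing G _)

theorem le_comap_of_sup_map_le {I : Ideal R} {A P : Ideal G}
    (h : A ⊔ I.map (algebraMap R G) ≤ P) : I ≤ P.comap (algebraMap R G) :=
  Ideal.map_le_iff_le_comap.mp (le_sup_right.trans h)

/-- The dimension bound is insensitive to replacing `I.map` by `(I ^ k).map`. -/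
theorem ringKrullDim_quotient_sup_map_pow_le {A : Ideal G} {I : Ideal R} {f : G} (k : ℕ) :
    ringKrullDim (G ⧸ (A ⊔ (I ^ k).map (algebraMap R G) ⊔ Ideal.span {f})) ≤
      ringKrullDim (G ⧸ (A ⊔ I.map (algebraMap R G) ⊔ Ideal.span {f})) := by
  refine ringKrullDim_quotient_le_of_forall_isPrime fun P hP hle => ?_
  refine sup_le (sup_le ?_ ?_) (le_sup_right.trans hle)
  · exact (le_sup_left.trans le_sup_left).trans hle
  · have h : (I.map (algebraMap R G)) ^ k ≤ P := by
      rw [← Ideal.map_pow]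
      exact (le_sup_right.trans le_sup_left).trans hle
    exact hP.le_of_pow_le h

theorem algebraMap_mem_sup_map_pow {A : Ideal G} {I : Ideal R} {f : G} {k : ℕ} {r : R}
    (hr : r ∈ I ^ k) :
    algebraMap R G r ∈ A ⊔ (I ^ k).map (algebraMap R G) ⊔ Ideal.span {f} :=
  Ideal.mem_sup_left (Ideal.mem_sup_right (Ideal.mem_map_of_mem _ hr))

theorem map_pow_le_annihilator {N : Type*} [AddCommGroup N] [Module R N] [Module G N]
    [IsScalarTower R G N] {I : Ideal R} {k : ℕ}
    (h : ∀ r ∈ I ^ k, ∀ x : N, r • x = 0) :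
    (I ^ k).map (algebraMap R G) ≤ Module.annihilator G N :=
  Ideal.map_le_iff_le_comap.mpr fun r hr => Module.mem_annihilator.mpr fun x =>
    (algebraMap_smul G r x).trans (h r hr x)

variable {N : Type*} [AddCommGroup N] [Module G N]

open IsLocalRing in
theorem ringKrullDim_annihilator_sup_le [IsLocalRing R] [GradedAlgebra 𝒜]
    (hstd : ∀ n : ℕ, 𝒜 n = 𝒜 1 ^ n) {e : ℕ}
    (hdim : mDim G N ≤ ((e + 2 : ℕ) : WithBot ℕ∞)) {f : G}
    (hf : ∀ P ∈ criticalPrimes ((maximalIdeal R).map (algebraMap R G)) N,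
      ¬ 𝒜 1 ≤ P.restrictScalars R → f ∉ P) :
    ringKrullDim (G ⧸ (Module.annihilator G N ⊔ (maximalIdeal R).map (algebraMap R G) ⊔
      Ideal.span {f})) ≤ ((e + 1 : ℕ) : WithBot ℕ∞) := by
  refine ringKrullDim_quotient_sup_span_singleton_le hstd
    (fun P _ hP => le_comap_of_sup_map_le hP)
    (fun P hP => hf P (Or.inl (Or.inr hP))) ?_
  exact (ringKrullDim_quotient_le_of_forall_isPrime
    fun P _ hP => le_sup_left.trans hP).trans hdim

open IsLocalRing in
theorem ringKrullDim_annihilator_quotient_sup_le [IsLocalRing R] [IsNoetherianRing G]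
    [GradedAlgebra 𝒜] [Module R N] [IsScalarTower R G N] [Module.Finite G N]
    (hstd : ∀ n : ℕ, 𝒜 n = 𝒜 1 ^ n) {e : ℕ}
    (hdim : mDim G N ≤ ((e + 2 : ℕ) : WithBot ℕ∞)) {f : G}
    (hf : ∀ P ∈ criticalPrimes ((maximalIdeal R).map (algebraMap R G)) N,
      ¬ 𝒜 1 ≤ P.restrictScalars R → f ∉ P) :
    ringKrullDim (G ⧸ (Module.annihilator G (N ⧸ H0 ((maximalIdeal R).map (algebraMap R G)) N) ⊔
      (maximalIdeal R).map (algebraMap R G) ⊔ Ideal.span {f})) ≤ (e : WithBot ℕ∞) := by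
  refine ringKrullDim_quotient_sup_span_singleton_le hstd
    (fun P _ hP => le_comap_of_sup_map_le hP) (fun P hP => hf P (Or.inr hP)) ?_
  refine ringKrullDim_quotient_le_of_minimalPrimes le_sup_left ?_ fun P hP hle => ?_
  · refine (ringKrullDim_quotient_le_of_forall_isPrime fun P _ hP => ?_).trans hdim
    refine le_trans ?_ hP
    exact (Submodule.mkQ _).annihilator_le_of_surjective (Submodule.mkQ_surjective _)
  · exact absurd (le_sup_right.trans hle) (not_map_le_of_mem_associatedPrimes_quotient_H0 _
      (Module.associatedPrimes.minimalPrimes_annihilator_subset_associatedPrimes G _ hP))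

end GeneralElement

namespace ModuleGrading

open IsLocalRing

variable {R G : Type*} [CommRing R] [IsNoetherianRing R] [IsLocalRing R]
    [CommRing G] [IsNoetherianRing G] [Algebra R G] {𝒜 : ℕ → Submodule R G} [GradedAlgebra 𝒜]
    {N : Type*} [AddCommGroup N] [Module R N] [Module G N] [IsScalarTower R G N]
    [Module.Finite G N]

/-- Normalized lengths of the components of the torsion part of `N` and of `N ⧸ f N`
have the same limit. -/
theorem exists_tendsto_natLength_H0 [Infinite (ResidueField R)] (𝒢 : ModuleGrading 𝒜 N)
    (hstd : ∀ n : ℕ, 𝒜 n = 𝒜 1 ^ n) (h𝒜 : ∀ i, (𝒜 i).FG) {e : ℕ}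
    (hdim : mDim G N ≤ ((e + 2 : ℕ) : WithBot ℕ∞)) {f : G} (hf : f ∈ 𝒜 1)
    (hfP : ∀ P ∈ criticalPrimes ((maximalIdeal R).map (algebraMap R G)) N,
      ¬ 𝒜 1 ≤ P.restrictScalars R → f ∉ P) :
    ∃ β : ℝ,
      Tendsto (fun n : ℕ => (((e + 1).factorial : ℝ) / (n : ℝ) ^ (e + 1)) * (natLength
        ((H0 ((maximalIdeal R).map (algebraMap R G)) N).restrictScalars R ⊓ 𝒢.comp n) : ℝ))
        atTop (nhds β) ∧
      Tendsto (fun n : ℕ => ((e.factorial : ℝ) / (n : ℝ) ^ e) * (natLength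
        ((H0 ((maximalIdeal R).map (algebraMap R G))
          (N ⧸ (Ideal.span {f} • ⊤ : Submodule G N))).restrictScalars R ⊓
          (𝒢.quotient _ (𝒢.isHomog_span_smul_top hf)).comp n) : ℝ)) atTop (nhds β) := by
  set M : Ideal G := (maximalIdeal R).map (algebraMap R G) with hM
  set W : Submodule G N := H0 M N with hWdef
  have hW : 𝒢.IsHomog W := 𝒢.isHomog_H0 _
  set K : Submodule G N := Ideal.span {f} • ⊤ with hKdef
  have hK : 𝒢.IsHomog K := 𝒢.isHomog_span_smul_top hf
  set 𝒬 := 𝒢.quotient K hK with h𝒬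
  have hWK : 𝒬.IsHomog (W.map K.mkQ) := 𝒢.isHomog_map_mkQ hK hW
  obtain ⟨k, hk⟩ := exists_pow_smul_H0_eq_zero (G := G) (N := N) (maximalIdeal R)
  have hkW : ∀ r ∈ maximalIdeal R ^ k, ∀ x : W, r • x = 0 := fun r hr x =>
    Subtype.ext (hk r hr x x.2)
  -- growth of `W ⧸ f W`
  have hannW : Module.annihilator G N ⊔ (maximalIdeal R ^ k).map (algebraMap R G) ≤
      Module.annihilator G W :=
    sup_le (W.subtype.annihilator_le_of_injective W.subtype_injective)
      (map_pow_le_annihilator hkW)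
  obtain ⟨β, hβ⟩ := exists_tendsto_natLength_comp hstd h𝒜 e
    ((𝒢.sub W hW).quotient _ ((𝒢.sub W hW).isHomog_span_smul_top hf)) (k := k)
    (sup_span_singleton_le_annihilator hannW f)
    (fun r hr => algebraMap_mem_sup_map_pow hr)
    ((ringKrullDim_quotient_sup_map_pow_le k).trans
      (ringKrullDim_annihilator_sup_le hstd hdim hfP))
  -- successive differences
  obtain ⟨n₀, h₀⟩ := (𝒢.sub W hW).exists_forall_ge_smul_eq_zero hstd (f := f)
    fun P hP => hfP P (Or.inl (Or.inl (Or.inl (Or.inl hP))))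
  obtain ⟨n₁, h₁⟩ := (𝒢.quotient W hW).exists_forall_ge_smul_eq_zero hstd (f := f)
    fun P hP => hfP P (Or.inl (Or.inl (Or.inl (Or.inr hP))))
  have hdiff : ∀ n, n₀ ≤ n → natLength (W.restrictScalars R ⊓ 𝒢.comp (n + 1)) =
      natLength (((𝒢.sub W hW).quotient _
        ((𝒢.sub W hW).isHomog_span_smul_top hf)).comp (n + 1)) +
      natLength (W.restrictScalars R ⊓ 𝒢.comp n) := fun n hn => by
    rw [← natLength_sub_comp _ _ hW, ← natLength_sub_comp _ _ hW]
    exact (𝒢.sub W hW).natLength_comp_succ_eq hf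
      ((𝒢.sub W hW).length_comp_ne_top h𝒜 hkW) (h₀ n hn)
  have hdiff' : ∀ n, max n₀ n₁ ≤ n → natLength (W.restrictScalars R ⊓ 𝒢.comp (n + 1)) =
      natLength ((W.map K.mkQ).restrictScalars R ⊓ 𝒬.comp (n + 1)) +
      natLength (W.restrictScalars R ⊓ 𝒢.comp n) := fun n hn => by
    rw [𝒢.map_mkQ_inf_comp hK hW]
    refine 𝒢.natLength_succ_eq hf W (𝒢.length_H0_inf_comp_ne_top h𝒜) (fun y hy hyn hfy => ?_)
      fun y hyn hfy => ?_
    · exact congrArg Subtype.val (h₀ n (le_of_max_le_left hn) ⟨y, hy⟩ hyn (Subtype.ext hfy))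
    · have := h₁ n (le_of_max_le_right hn) (W.mkQ y) ⟨y, hyn, rfl⟩ (by
        rw [← map_smul, Submodule.mkQ_apply, Submodule.Quotient.mk_eq_zero]; exact hfy)
      rwa [Submodule.mkQ_apply, Submodule.Quotient.mk_eq_zero] at this
  have hWbar : Tendsto (fun n : ℕ => ((e.factorial : ℝ) / (n : ℝ) ^ e) *
      (natLength ((W.map K.mkQ).restrictScalars R ⊓ 𝒬.comp n) : ℝ)) atTop (nhds β) := by
    refine hβ.congr' ?_
    filter_upwards [Filter.eventually_ge_atTop (max n₀ n₁ + 1)] with n hn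
    obtain ⟨n, rfl⟩ : ∃ j, n = j + 1 := ⟨n - 1, by omega⟩
    have h2 := hdiff n (by omega)
    have h3 := hdiff' n (by omega)
    rw [show natLength ((W.map K.mkQ).restrictScalars R ⊓ 𝒬.comp (n + 1)) = _ by
      exact (Nat.add_right_cancel (h2.symm.trans h3)).symm]
  refine ⟨β, tendsto_of_tendsto_succ_sub ?_ hβ, ?_⟩
  · filter_upwards [Filter.eventually_ge_atTop n₀] with n hn
    rw [hdiff n hn]
    push_cast
    ring
  -- comparison of `H⁰(N ⧸ f N)` with the image of `W`
  have hle : W.map K.mkQ ≤ H0 M (N ⧸ K) := map_H0_le _ K.mkQ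
  obtain ⟨l, hl⟩ := exists_pow_smul_H0_eq_zero (G := G) (N := (N ⧸ K) ⧸ W.map K.mkQ)
    (maximalIdeal R)
  set V : Submodule G ((N ⧸ K) ⧸ W.map K.mkQ) := H0 M ((N ⧸ K) ⧸ W.map K.mkQ) with hVdef
  have hV : (𝒬.quotient _ hWK).IsHomog V := (𝒬.quotient _ hWK).isHomog_H0 _
  have hannV : Module.annihilator G (N ⧸ W) ⊔ (maximalIdeal R ^ l).map (algebraMap R G) ⊔
      Ideal.span {f} ≤ Module.annihilator G V := by
    refine sup_le (sup_le ?_ (map_pow_le_annihilator fun r hr x => Subtype.ext (hl r hr x x.2))) ?_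
    · refine le_trans (fun g hg => Module.mem_annihilator.mpr fun z => ?_)
        (V.subtype.annihilator_le_of_injective V.subtype_injective)
      obtain ⟨z, rfl⟩ := Submodule.mkQ_surjective _ z
      obtain ⟨z, rfl⟩ := Submodule.mkQ_surjective _ z
      have h := Module.mem_annihilator.mp hg (W.mkQ z)
      rw [← map_smul, Submodule.mkQ_apply, Submodule.Quotient.mk_eq_zero] at h
      rw [← map_smul, ← map_smul, Submodule.mkQ_apply, Submodule.Quotient.mk_eq_zero]
      exact ⟨g • z, h, rfl⟩
    · refine (Ideal.span_singleton_le_iff_mem _).mpr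
        ((V.subtype.annihilator_le_of_injective V.subtype_injective) ?_)
      refine Module.mem_annihilator.mpr fun z => ?_
      obtain ⟨z, rfl⟩ := Submodule.mkQ_surjective _ z
      obtain ⟨z, rfl⟩ := Submodule.mkQ_surjective _ z
      rw [← map_smul, ← map_smul, Submodule.mkQ_apply K,
        (Submodule.Quotient.mk_eq_zero K).mpr (mem_span_smul_top.mpr ⟨z, rfl⟩), map_zero]
  have hV0 := tendsto_natLength_comp_zero hstd h𝒜 e ((𝒬.quotient _ hWK).sub V hV) (k := l)
    hannV (fun r hr => algebraMap_mem_sup_map_pow hr)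
    ((ringKrullDim_quotient_sup_map_pow_le l).trans
      (ringKrullDim_annihilator_quotient_sup_le hstd hdim hfP))
  have hsum := hV0.add hWbar
  rw [zero_add] at hsum
  refine tendsto_of_tendsto_of_tendsto_of_le_of_le hWbar hsum (fun n => ?_) fun n => ?_
  · refine mul_le_mul_of_nonneg_left ?_ (by positivity)
    have hle' : (W.map K.mkQ).restrictScalars R ≤ (H0 M (N ⧸ K)).restrictScalars R := hle
    exact Nat.cast_le.mpr (natLength_mono (𝒬.length_H0_inf_comp_ne_top h𝒜 n)
      (inf_le_inf_right _ hle'))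
  · dsimp only
    rw [← mul_add]
    refine mul_le_mul_of_nonneg_left ?_ (by positivity)
    have h := 𝒬.natLength_H0_inf_comp_le h𝒜 hWK n
    rw [← hM, inf_eq_right.mpr hle] at h
    rw [natLength_sub_comp]
    exact_mod_cast h

end ModuleGrading

/-- Lemma 2.3: if `d ≥ 2`, `dim_G L ≤ d` and `dim_{G₀} Lₙ < dim_G L` for all `n`, then for
a general `f ∈ G₁` one has `dim_G (L/fL) ≤ d − 1` and `j_d(G, L) = j_{d−1}(G, L/fL)`. -/
theorem stmt_4 {R G : Type*} [CommRing R] [IsNoetherianRing R] [IsLocalRing R]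
    (hres : Infinite (IsLocalRing.ResidueField R))
    [CommRing G] [IsNoetherianRing G] [Algebra R G]
    (𝒜 : ℕ → Submodule R G) [GradedAlgebra 𝒜]
    (hstd : ∀ n : ℕ, 𝒜 n = 𝒜 1 ^ n)
    (L : Type*) [AddCommGroup L] [Module R L] [Module G L] [IsScalarTower R G L]
    [Module.Finite G L]
    (ℳ : ℕ → Submodule R L) [DirectSum.Decomposition ℳ] [SetLike.GradedSMul 𝒜 ℳ]
    (d : ℕ) (hd : 2 ≤ d) (hLd : mDim G L ≤ (d : WithBot ℕ∞))
    (hcomp : ∀ n : ℕ, mDim R (ℳ n) < mDim G L) :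
    GeneralDeg1 𝒜 fun f =>
      mDim G (L ⧸ (Ideal.span {f} • ⊤ : Submodule G L)) ≤ ((d - 1 : ℕ) : WithBot ℕ∞) ∧
      jMultGr R (Ideal.map (algebraMap R G) (IsLocalRing.maximalIdeal R)) L ℳ d =
        jMultGr R (Ideal.map (algebraMap R G) (IsLocalRing.maximalIdeal R))
          (L ⧸ (Ideal.span {f} • ⊤ : Submodule G L))
          (fun n => Submodule.map
            (((Ideal.span {f} • ⊤ : Submodule G L).mkQ).restrictScalars R) (ℳ n))
          (d - 1) := by
  intro m x hx hspan
  let 𝒢 : ModuleGrading 𝒜 L := ModuleGrading.ofDecomposition ℳ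
  let M : Ideal G := Ideal.map (algebraMap R G) (IsLocalRing.maximalIdeal R)
  have h1 : (𝒜 1).FG := hspan ▸ Submodule.fg_span (Set.finite_range x)
  have h𝒜 : ∀ i, (𝒜 i).FG := fun i => hstd i ▸ h1.pow i
  obtain ⟨e, rfl⟩ : ∃ e, d = e + 2 := ⟨d - 2, by omega⟩
  let T : Set (Ideal G) := {P | P ∈ criticalPrimes M L ∧ ¬ 𝒜 1 ≤ P.restrictScalars R}
  have hT : T.Finite := (finite_criticalPrimes M L).subset fun P hP => hP.1
  obtain ⟨F, hF, hcF⟩ := exists_mvPolynomial_forall_notMem (x := x)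
    (hT.image (Submodule.restrictScalars R)) (by rintro _ ⟨P, hP, rfl⟩; exact hspan ▸ hP.2)
  refine ⟨F, hF, fun c hc => ?_⟩
  have hf : ∑ l, c l • x l ∈ 𝒜 1 :=
    Submodule.sum_mem _ fun l _ => Submodule.smul_mem _ _ (hx l)
  have hfP : ∀ P ∈ criticalPrimes M L, ¬ 𝒜 1 ≤ P.restrictScalars R → ∑ l, c l • x l ∉ P :=
    fun P hP h => hcF c hc _ ⟨P, ⟨hP, h⟩, rfl⟩
  refine ⟨𝒢.mDim_quotient_le hstd hLd hcomp fun P hP =>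
    hfP P (Or.inl (Or.inl (Or.inr hP))), ?_⟩
  obtain ⟨β, hβ, hβ'⟩ := 𝒢.exists_tendsto_natLength_H0 hstd h𝒜 hLd hf hfP
  exact hβ.limUnder_eq.trans hβ'.limUnder_eq.symm

end
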